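/- Let P ∈ ℂ[X, Y] be a polynomial in two variables that is irreducible in ℂ[X, Y], has degree at least 1 in Y, and is not a scalar multiple of Y. Then the set { z ∈ ℂ : P(z, e^z) = 0 } is infinite. -/

import Mathlib

open Complex MvPolynomial

lemma Polynomial.eq_zero_of_derivative_add_C_mul_eq_zero {c : ℂ} (hc : c ≠ 0)
    {p : Polynomial ℂ} (h : Polynomial.derivative p + Polynomial.C c * p = 0) : p = 0 := by
  by_contra hp
  have hlt := Polynomial.degree_derivative_lt hp
  rw [eq_neg_of_add_eq_zero_left h, Polynomial.degree_neg, Polynomial.degree_C_mul hc] at hlt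
  exact lt_irrefl _ hlt

/-- Exponentials with distinct frequencies are linearly independent over the polynomials. -/
lemma Polynomial.eq_zero_of_sum_eval_mul_exp_eq_zero {ι : Type*} (s : Finset ι) :
    ∀ (e : ι → ℂ) (_ : Set.InjOn e s) (p : ι → Polynomial ℂ),
      (∀ z, ∑ i ∈ s, (p i).eval z * exp (e i * z) = 0) → ∀ i ∈ s, p i = 0 := by
  classical
  induction s using Finset.induction_on with
  | empty => simp
  | insert a s ha ih =>
    intro e he p hp
    let T : ℂ → Polynomial ℂ → Polynomial ℂ := fun c q ↦
      Polynomial.derivative q + Polynomial.C c * q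
    have hne : ∀ i ∈ s, e i - e a ≠ 0 := fun i hi h ↦ ha <| by
      have := he (Finset.mem_insert_of_mem hi) (Finset.mem_insert_self a s) (sub_eq_zero.mp h)
      exact this ▸ hi
    have key : ∀ m : ℕ, ∀ z, (Polynomial.derivative^[m] (p a)).eval z +
        ∑ i ∈ s, ((T (e i - e a))^[m] (p i)).eval z * exp ((e i - e a) * z) = 0 := by
      intro m
      induction m with
      | zero =>
        intro z
        have := congrArg (· * exp (-(e a * z))) (hp z)
        simp only [Finset.sum_insert ha, add_mul, Finset.sum_mul, zero_mul, mul_assoc,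
          ← Complex.exp_add] at this
        simpa [sub_mul, ← sub_eq_add_neg] using this
      | succ m ihm =>
        intro z
        have hd : HasDerivAt (fun z ↦ (Polynomial.derivative^[m] (p a)).eval z +
            ∑ i ∈ s, ((T (e i - e a))^[m] (p i)).eval z * exp ((e i - e a) * z))
            ((Polynomial.derivative (Polynomial.derivative^[m] (p a))).eval z +
            ∑ i ∈ s, ((Polynomial.derivative ((T (e i - e a))^[m] (p i))).eval z *
              exp ((e i - e a) * z) + ((T (e i - e a))^[m] (p i)).eval z *
              (exp ((e i - e a) * z) * ((e i - e a) * 1)))) z := by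
          refine (Polynomial.hasDerivAt _ z).add (HasDerivAt.fun_sum fun i _ ↦ ?_)
          exact (Polynomial.hasDerivAt _ z).mul (((hasDerivAt_id z).const_mul _).cexp)
        have h0 := hd.unique ((hasDerivAt_const z (0 : ℂ)).congr_of_eventuallyEq
          (Filter.Eventually.of_forall ihm))
        rw [← h0, Function.iterate_succ_apply']
        congr 1
        refine Finset.sum_congr rfl fun i _ ↦ ?_
        rw [Function.iterate_succ_apply']
        simp only [T, Polynomial.eval_add, Polynomial.eval_mul, Polynomial.eval_C]
        ring
    have hs : ∀ i ∈ s, p i = 0 := by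
      intro i hi
      have h1 := ih (fun i ↦ e i - e a)
        (fun x hx y hy hxy ↦ he (Finset.mem_insert_of_mem hx) (Finset.mem_insert_of_mem hy)
          (sub_left_injective hxy))
        (fun i ↦ (T (e i - e a))^[(p a).natDegree + 1] (p i)) (fun z ↦ by
          simpa [Polynomial.iterate_derivative_eq_zero (Nat.lt_succ_self (p a).natDegree)]
            using key ((p a).natDegree + 1) z) i hi
      have h2 : ∀ (m : ℕ) (q : Polynomial ℂ), (T (e i - e a))^[m] q = 0 → q = 0 := by
        intro m
        induction m with
        | zero => exact fun q hq ↦ hq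
        | succ m ihm =>
          exact fun q hq ↦
            Polynomial.eq_zero_of_derivative_add_C_mul_eq_zero (hne i hi) (ihm _ hq)
      exact h2 _ _ h1
    have hpa : p a = 0 := by
      refine Polynomial.funext fun z ↦ ?_
      have := hp z
      rw [Finset.sum_insert ha, Finset.sum_eq_zero (fun i hi ↦ by simp [hs i hi])] at this
      simpa using this
    intro i hi
    rcases Finset.mem_insert.mp hi with rfl | hi
    exacts [hpa, hs i hi]

/-- An entire function of at most exponential growth. -/
structure IsEntireOfExpType (f : ℂ → ℂ) : Prop where
  differentiable : Differentiable ℂ f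
  exists_norm_le : ∃ A B : ℝ, 0 ≤ A ∧ 0 ≤ B ∧ ∀ z, ‖f z‖ ≤ A * Real.exp (B * ‖z‖)

namespace IsEntireOfExpType

variable {f g : ℂ → ℂ}

lemma const (c : ℂ) : IsEntireOfExpType fun _ ↦ c :=
  ⟨differentiable_const c, ‖c‖, 0, norm_nonneg c, le_rfl, by simp⟩

lemma id : IsEntireOfExpType fun z ↦ z :=
  ⟨differentiable_id, 1, 1, zero_le_one, zero_le_one, fun z ↦ by
    have := Real.add_one_le_exp ‖z‖
    simp only [one_mul]
    linarith⟩

lemma complexExp : IsEntireOfExpType Complex.exp :=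
  ⟨differentiable_exp, 1, 1, zero_le_one, zero_le_one, fun z ↦ by
    simpa [Complex.norm_exp] using Complex.re_le_norm z⟩

lemma add (hf : IsEntireOfExpType f) (hg : IsEntireOfExpType g) :
    IsEntireOfExpType fun z ↦ f z + g z := by
  obtain ⟨hf, A, B, hA, hB, h⟩ := hf
  obtain ⟨hg, A', B', hA', hB', h'⟩ := hg
  refine ⟨hf.add hg, A + A', B + B', by positivity, by positivity, fun z ↦ ?_⟩
  have h1 : A * Real.exp (B * ‖z‖) ≤ A * Real.exp ((B + B') * ‖z‖) := by gcongr; linarith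
  have h2 : A' * Real.exp (B' * ‖z‖) ≤ A' * Real.exp ((B + B') * ‖z‖) := by gcongr; linarith
  linarith [norm_add_le (f z) (g z), h z, h' z]

lemma mul (hf : IsEntireOfExpType f) (hg : IsEntireOfExpType g) :
    IsEntireOfExpType fun z ↦ f z * g z := by
  obtain ⟨hf, A, B, hA, hB, h⟩ := hf
  obtain ⟨hg, A', B', hA', hB', h'⟩ := hg
  refine ⟨hf.mul hg, A * A', B + B', by positivity, by positivity, fun z ↦ ?_⟩
  calc ‖f z * g z‖ ≤ (A * Real.exp (B * ‖z‖)) * (A' * Real.exp (B' * ‖z‖)) := by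
        rw [norm_mul]
        gcongr
        exacts [h z, h' z]
    _ = A * A' * Real.exp ((B + B') * ‖z‖) := by rw [add_mul, Real.exp_add]; ring

lemma eval_cexp (P : MvPolynomial (Fin 2) ℂ) :
    IsEntireOfExpType fun z ↦ MvPolynomial.eval ![z, Complex.exp z] P := by
  induction P using MvPolynomial.induction_on with
  | C a => simpa using const a
  | add p q hp hq => simpa using hp.add hq
  | mul_X p i hp =>
    fin_cases i
    · simpa using hp.mul id
    · simpa using hp.mul complexExp

lemma dslope (hf : IsEntireOfExpType f) {a : ℂ} (ha : f a = 0) :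
    IsEntireOfExpType (dslope f a) := by
  obtain ⟨hf, A, B, hA, hB, h⟩ := hf
  have hd : Differentiable ℂ (_root_.dslope f a) := by
    rw [← differentiableOn_univ]
    exact (Complex.differentiableOn_dslope Filter.univ_mem).mpr hf.differentiableOn
  obtain ⟨M, hM⟩ := (isCompact_closedBall a 1).exists_bound_of_continuousOn
    hd.continuous.continuousOn
  have hM0 : 0 ≤ M := (norm_nonneg _).trans (hM a (by simp))
  refine ⟨hd, A + M, B, by positivity, hB, fun z ↦ ?_⟩
  have hE : 1 ≤ Real.exp (B * ‖z‖) := Real.one_le_exp (by positivity)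
  rcases le_total (dist z a) 1 with hz | hz
  · nlinarith [hM z hz]
  · have hne : z ≠ a := by
      rintro rfl
      norm_num at hz
    have hle : ‖_root_.dslope f a z‖ ≤ ‖f z‖ := by
      rw [dslope_of_ne _ hne, slope_def_field, ha, sub_zero, norm_div]
      exact div_le_self (norm_nonneg _) (by rwa [← dist_eq_norm])
    nlinarith [h z]

lemma exists_eq_pow_mul (hf : IsEntireOfExpType f) (h0 : ∃ z, f z ≠ 0) (a : ℂ) :
    ∃ (n : ℕ) (g : ℂ → ℂ), IsEntireOfExpType g ∧ g a ≠ 0 ∧ ∀ z, f z = (z - a) ^ n * g z := by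
  obtain ⟨p, hp⟩ := hf.differentiable.analyticAt a
  have hp0 : p ≠ 0 := by
    rintro rfl
    obtain ⟨z, hz⟩ := h0
    have hA : AnalyticOnNhd ℂ f Set.univ := fun z _ ↦ hf.differentiable.analyticAt z
    exact hz (hA.eqOn_zero_of_preconnected_of_eventuallyEq_zero isPreconnected_univ
      (Set.mem_univ a) hp.eventually_eq_zero (Set.mem_univ z))
  refine ⟨p.order, (Function.swap _root_.dslope a)^[p.order] f, ?_,
    hp.iterate_dslope_fslope_ne_zero hp0, hp.eq_pow_order_mul_iterate_dslope⟩
  have hk : ∀ k ≤ p.order, IsEntireOfExpType ((Function.swap _root_.dslope a)^[k] f) := by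
    intro k
    induction k with
    | zero => exact fun _ ↦ hf
    | succ k ih =>
      intro hk
      rw [Function.iterate_succ_apply']
      refine (ih (by omega)).dslope ?_
      rw [← (hp.has_fpower_series_iterate_dslope_fslope k).coeff_zero 1,
        ← FormalMultilinearSeries.coeff, FormalMultilinearSeries.coeff_iterate_fslope,
        zero_add, FormalMultilinearSeries.coeff, p.apply_eq_zero_of_lt_order (by omega),
        _root_.zero_apply]
  exact hk _ le_rfl

lemma exists_eq_polynomial_mul (s : Finset ℂ) :
    ∀ {f : ℂ → ℂ}, IsEntireOfExpType f → (∃ z, f z ≠ 0) → (∀ z, f z = 0 → z ∈ s) →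
      ∃ (Q : Polynomial ℂ) (g : ℂ → ℂ), Q ≠ 0 ∧ IsEntireOfExpType g ∧ (∀ z, g z ≠ 0) ∧
        ∀ z, f z = Q.eval z * g z := by
  classical
  induction s using Finset.induction_on with
  | empty =>
    intro f hf _ hs
    exact ⟨1, f, one_ne_zero, hf, fun z hz ↦ by simpa using hs z hz, by simp⟩
  | insert a s ha ih =>
    intro f hf h0 hs
    obtain ⟨n, g, hg, hga, hfg⟩ := hf.exists_eq_pow_mul h0 a
    obtain ⟨Q, k, hQ, hk, hk0, hgk⟩ := ih hg ⟨a, hga⟩ fun z hz ↦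
      Finset.mem_of_mem_insert_of_ne (hs z (by rw [hfg, hz, mul_zero])) fun h ↦ hga (h ▸ hz)
    refine ⟨(Polynomial.X - Polynomial.C a) ^ n * Q, k,
      mul_ne_zero (pow_ne_zero _ (Polynomial.X_sub_C_ne_zero a)) hQ, hk, hk0, fun z ↦ ?_⟩
    rw [hfg, hgk]
    simp [mul_assoc]

/-- A nowhere vanishing entire function of exponential type is an exponential. -/
lemma exists_eq_const_mul_exp (hf : IsEntireOfExpType f) (h0 : ∀ z, f z ≠ 0) :
    ∃ b : ℂ, ∀ z, f z = f 0 * exp (b * z) := by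
  obtain ⟨hd, A, B, hA, hB, hbd⟩ := hf
  have hd' : Differentiable ℂ (deriv f) := by
    rw [← differentiableOn_univ]
    exact hd.differentiableOn.deriv isOpen_univ
  obtain ⟨L₀, hL₀⟩ := (hd'.div hd h0).isExactOn_univ
  obtain ⟨L, hL, hL0⟩ : ∃ L : ℂ → ℂ, (∀ z, HasDerivAt L (deriv f z / f z) z) ∧ L 0 = 0 :=
    ⟨fun z ↦ L₀ z - L₀ 0, fun z ↦ (hL₀ z (Set.mem_univ z)).sub_const _, sub_self _⟩
  have hLd : Differentiable ℂ L := fun z ↦ (hL z).differentiableAt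
  have hfL : ∀ z, f z = f 0 * exp (L z) := by
    have hder : ∀ z, HasDerivAt (fun z ↦ f z * exp (-L z)) 0 z := fun z ↦ by
      refine ((hd z).hasDerivAt.mul (hL z).neg.cexp).congr_deriv ?_
      have := h0 z
      simp only [Pi.neg_apply]
      field_simp
      ring
    intro z
    have := is_const_of_deriv_eq_zero (fun z ↦ (hder z).differentiableAt)
      (fun z ↦ (hder z).deriv) z 0
    simp only [hL0, neg_zero, Complex.exp_zero, mul_one] at this
    rw [← this, mul_assoc, ← Complex.exp_add, neg_add_cancel, Complex.exp_zero, mul_one]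
  have hf0 : 0 < ‖f 0‖ := norm_pos_iff.mpr (h0 0)
  have hA0 : 0 < A := by
    have := hbd 0
    simp only [norm_zero, mul_zero, Real.exp_zero, mul_one] at this
    linarith
  set K : ℝ := |Real.log (A / ‖f 0‖)| + 1
  have hK0 : 0 < K := by positivity
  have hre : ∀ z, (L z).re ≤ K + B * ‖z‖ := by
    intro z
    have h1 := hbd z
    rw [hfL, norm_mul, Complex.norm_exp] at h1
    have h2 : Real.exp (L z).re ≤ A / ‖f 0‖ * Real.exp (B * ‖z‖) := by
      rw [div_mul_eq_mul_div, le_div_iff₀ hf0]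
      linarith
    rw [← Real.exp_log (div_pos hA0 hf0), ← Real.exp_add, Real.exp_le_exp] at h2
    linarith [le_abs_self (Real.log (A / ‖f 0‖))]
  have hLn : ∀ z, z ≠ 0 → ‖L z‖ ≤ 2 * (K + B * (2 * ‖z‖)) := by
    intro z hz
    have hz0 : 0 < ‖z‖ := norm_pos_iff.mpr hz
    have := borelCaratheodory_zero (f := L) (M := K + B * (2 * ‖z‖)) (R := 2 * ‖z‖) (z := z)
      (by positivity) hLd.differentiableOn
      (fun w hw ↦ by
        have hw' : ‖w‖ ≤ 2 * ‖z‖ := (mem_ball_zero_iff.mp hw).le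
        have : B * ‖w‖ ≤ B * (2 * ‖z‖) := by gcongr
        exact (hre w).trans (by linarith))
      (by positivity) (by rw [mem_ball_zero_iff]; linarith) hL0
    rwa [show 2 * ‖z‖ - ‖z‖ = ‖z‖ by ring, mul_div_cancel_right₀ _ hz0.ne'] at this
  have hS : Differentiable ℂ (_root_.dslope L 0) := by
    rw [← differentiableOn_univ]
    exact (Complex.differentiableOn_dslope Filter.univ_mem).mpr hLd.differentiableOn
  obtain ⟨M, hM⟩ := (isCompact_closedBall (0 : ℂ) 1).exists_bound_of_continuousOn
    hS.continuous.continuousOn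
  have hb : Bornology.IsBounded (Set.range (_root_.dslope L 0)) := by
    refine isBounded_iff_forall_norm_le.mpr ⟨max M (2 * (K + 2 * B)), ?_⟩
    rintro _ ⟨z, rfl⟩
    rcases le_total ‖z‖ 1 with hz | hz
    · exact (hM z (by simpa using hz)).trans (le_max_left _ _)
    · have hz0 : 0 < ‖z‖ := by linarith
      have hne : z ≠ 0 := norm_pos_iff.mp hz0
      refine le_trans ?_ (le_max_right _ _)
      rw [dslope_of_ne _ hne, slope_def_field, hL0, sub_zero, sub_zero, norm_div,
        div_le_iff₀ hz0]
      nlinarith [hLn z hne]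
  refine ⟨_root_.dslope L 0 0, fun z ↦ ?_⟩
  have h1 := sub_smul_dslope L 0 z
  rw [hS.apply_eq_apply_of_bounded hb z 0, hL0, sub_zero, sub_zero, smul_eq_mul] at h1
  rw [hfL z, ← h1, mul_comm z]

end IsEntireOfExpType

/-- The canonical ring homomorphism `ℂ[X][Y] → ℂ[X, Y]`. -/
noncomputable def Polynomial.toMvPolynomialFinTwo :
    Polynomial (Polynomial ℂ) →+* MvPolynomial (Fin 2) ℂ :=
  Polynomial.eval₂RingHom
    (Polynomial.aeval (MvPolynomial.X 0 : MvPolynomial (Fin 2) ℂ)).toRingHom (MvPolynomial.X 1)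

/-- Every `P ∈ ℂ[X, Y]` is the image of an element of `ℂ[X][Y]`. -/
lemma Polynomial.toMvPolynomialFinTwo_surjective :
    Function.Surjective Polynomial.toMvPolynomialFinTwo := by
  intro P
  induction P using MvPolynomial.induction_on with
  | C a => exact ⟨Polynomial.C (Polynomial.C a), by
      simp [toMvPolynomialFinTwo, MvPolynomial.algebraMap_eq]⟩
  | add p q hp hq =>
    obtain ⟨p, rfl⟩ := hp
    obtain ⟨q, rfl⟩ := hq
    exact ⟨p + q, map_add _ _ _⟩
  | mul_X p i hp =>
    obtain ⟨p, rfl⟩ := hp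
    fin_cases i
    · exact ⟨p * Polynomial.C Polynomial.X, by simp [toMvPolynomialFinTwo]⟩
    · exact ⟨p * Polynomial.X, by simp [toMvPolynomialFinTwo]⟩

lemma Polynomial.eval_toMvPolynomialFinTwo (R : Polynomial (Polynomial ℂ)) (v : Fin 2 → ℂ) :
    MvPolynomial.eval v (Polynomial.toMvPolynomialFinTwo R) =
      ∑ k ∈ Finset.range (R.natDegree + 1), (R.coeff k).eval (v 0) * v 1 ^ k := by
  have h : ∀ p : Polynomial ℂ, MvPolynomial.eval v
      (Polynomial.aeval (MvPolynomial.X 0 : MvPolynomial (Fin 2) ℂ) p) = p.eval (v 0) := by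
    intro p
    induction p using Polynomial.induction_on' with
    | add p q hp hq => simp [hp, hq]
    | monomial n a => simp [MvPolynomial.algebraMap_eq]
  simp [toMvPolynomialFinTwo, Polynomial.eval₂_eq_sum_range, h]

lemma Polynomial.degreeOf_one_aeval_X_zero (p : Polynomial ℂ) :
    (Polynomial.aeval (MvPolynomial.X 0 : MvPolynomial (Fin 2) ℂ) p).degreeOf 1 = 0 := by
  induction p using Polynomial.induction_on' with
  | add p q hp hq =>
    have := MvPolynomial.degreeOf_add_le 1 (Polynomial.aeval (MvPolynomial.X 0 :
      MvPolynomial (Fin 2) ℂ) p) (Polynomial.aeval (MvPolynomial.X 0) q)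
    rw [map_add]
    omega
  | monomial n a =>
    rw [Polynomial.aeval_monomial, MvPolynomial.algebraMap_eq]
    refine Nat.le_zero.mp ((MvPolynomial.degreeOf_C_mul_le _ _ _).trans ?_)
    rw [MvPolynomial.degreeOf_X_pow_of_ne n (by decide)]

/-- If `R(z, e^z) = Q(z) e^{bz}` with `Q ≠ 0`, then `R = Q Y^j` for some `j`. -/
lemma Polynomial.exists_eq_C_mul_X_pow_of_eval_exp {R : Polynomial (Polynomial ℂ)}
    {Q : Polynomial ℂ} {b : ℂ} (hQ : Q ≠ 0)
    (h : ∀ z, ∑ k ∈ Finset.range (R.natDegree + 1), (R.coeff k).eval z * exp z ^ k =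
      Q.eval z * exp (b * z)) :
    ∃ j : ℕ, R = Polynomial.C Q * Polynomial.X ^ j := by
  have hsum : ∀ N, R.natDegree < N → ∀ z,
      ∑ k ∈ Finset.range N, (R.coeff k).eval z * exp (k * z) = Q.eval z * exp (b * z) := by
    intro N hN z
    rw [← h z]
    symm
    simp only [Complex.exp_nat_mul]
    refine Finset.sum_subset (Finset.range_mono hN) fun k _ hk ↦ ?_
    rw [Polynomial.coeff_eq_zero_of_natDegree_lt (by simpa using hk)]
    simp
  by_cases hb : ∃ j : ℕ, (j : ℂ) = b
  · obtain ⟨j, rfl⟩ := hb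
    refine ⟨j, ?_⟩
    have key := Polynomial.eq_zero_of_sum_eval_mul_exp_eq_zero
      (Finset.range (R.natDegree + j + 1)) (fun k : ℕ ↦ (k : ℂ)) (Nat.cast_injective.injOn)
      (fun k ↦ R.coeff k - if k = j then Q else 0) (fun z ↦ by
        simp only [Polynomial.eval_sub, sub_mul, Finset.sum_sub_distrib]
        rw [hsum _ (by omega), Finset.sum_eq_single_of_mem j (by simp)]
        · simp
        · intro k _ hk
          simp [hk])
    ext1 k
    rw [Polynomial.coeff_C_mul_X_pow]
    by_cases hk : k < R.natDegree + j + 1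
    · exact sub_eq_zero.mp (key k (by simpa using hk))
    · rw [Polynomial.coeff_eq_zero_of_natDegree_lt (by omega), if_neg (by omega)]
  · refine absurd ?_ hQ
    have key := Polynomial.eq_zero_of_sum_eval_mul_exp_eq_zero
      (Finset.insertNone (Finset.range (R.natDegree + 1)))
      (fun k : Option ℕ ↦ k.elim b (fun k : ℕ ↦ (k : ℂ)))
      (fun x _ y _ hxy ↦ by
        cases x <;> cases y <;> simp_all [eq_comm])
      (fun k ↦ k.elim (-Q) R.coeff) (fun z ↦ by
        simp [Finset.sum_insertNone, hsum _ (Nat.lt_succ_self R.natDegree) z])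
      none (by simp)
    simpa using key

/-- If `P ∈ ℂ[X, Y]` is irreducible, has degree at least `1` in `Y`, and is not a scalar
multiple of `Y`, then the entire function `z ↦ P (z, e^z)` has infinitely many zeros.
(Here the variable `X` is `X 0` and the variable `Y` is `X 1`.) -/
theorem infinitely_many_zeros_of_exp_polynomial
    (P : MvPolynomial (Fin 2) ℂ) (hP : Irreducible P)
    (hdeg : 1 ≤ P.degreeOf 1)
    (hY : ¬ ∃ c : ℂ, P = MvPolynomial.C c * MvPolynomial.X 1) :
    {z : ℂ | MvPolynomial.eval ![z, Complex.exp z] P = 0}.Infinite := by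
  intro hfin
  have hE := IsEntireOfExpType.eval_cexp P
  have hne : ∃ z, MvPolynomial.eval ![z, Complex.exp z] P ≠ 0 := by
    by_contra! hz
    exact Set.infinite_univ (hfin.subset fun z _ ↦ hz z)
  obtain ⟨Q, g, hQ, hg, hg0, hPQ⟩ := IsEntireOfExpType.exists_eq_polynomial_mul hfin.toFinset
    hE hne (fun z hz ↦ by simpa using hz)
  obtain ⟨b, hb⟩ := hg.exists_eq_const_mul_exp hg0
  obtain ⟨R, rfl⟩ := Polynomial.toMvPolynomialFinTwo_surjective P
  obtain ⟨j, rfl⟩ := Polynomial.exists_eq_C_mul_X_pow_of_eval_exp (R := R)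
    (Q := Q * Polynomial.C (g 0)) (b := b)
    (mul_ne_zero hQ (Polynomial.C_ne_zero.mpr (hg0 0))) (fun z ↦ by
      have := hPQ z
      rw [Polynomial.eval_toMvPolynomialFinTwo, hb z] at this
      simpa [mul_assoc] using this)
  set q := Q * Polynomial.C (g 0)
  have hmap : Polynomial.toMvPolynomialFinTwo (Polynomial.C q * Polynomial.X ^ j) =
      Polynomial.aeval (MvPolynomial.X 0 : MvPolynomial (Fin 2) ℂ) q * MvPolynomial.X 1 ^ j := by
    simp [Polynomial.toMvPolynomialFinTwo]
  rw [hmap] at hP hdeg hY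
  cases j with
  | zero => simp [Polynomial.degreeOf_one_aeval_X_zero] at hdeg
  | succ j =>
    rw [pow_succ, ← mul_assoc] at hP hY
    rcases hP.isUnit_or_isUnit rfl with hu | hu
    · obtain ⟨c, -, hc⟩ := MvPolynomial.isUnit_iff_eq_C_of_isReduced.mp hu
      exact hY ⟨c, by rw [hc]⟩
    · exact MvPolynomial.X_prime.not_isUnit hu
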